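/- arXiv:1301.1154 — 2 statements merged into one kernel-verified Lean document; each statement's English description precedes it below -/
import Mathlib

section
/- Let A be a Noetherian ring and let I and J be ideals of A. Then there exists an integer λ ≥ 0 such that for every element x ∈ A and all natural numbers n, m with n ≥ λm, one has (x^n) ∩ (J + I^m) = ((x^{λm}) ∩ (J + I^m)) · (x^{n − λm}), where (x^k) denotes the principal ideal generated by x^k and the product on the right is the product of ideals. -/
/-- In a Noetherian ring, the saturations of an ideal with respect to all elements stabilize
at a common exponent. -/
theorem Ideal.exists_forall_mul_pow_mem_of_mul_pow_mem {R : Type*} [CommRing R]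
    [IsNoetherianRing R] (K : Ideal R) :
    ∃ l : ℕ, ∀ a x : R, ∀ n : ℕ, a * x ^ n ∈ K → a * x ^ l ∈ K := by
  obtain ⟨s, rfl, hs⟩ := Submodule.isLasker R R K
  have hrad (Q : Ideal R) : ∃ l : ℕ, Q.radical ^ l ≤ Q :=
    Q.exists_radical_pow_le_of_fg Q.radical.fg_of_isNoetherianRing
  choose f hf using hrad
  refine ⟨s.sup f, fun a x n h ↦ ?_⟩
  rw [Submodule.mem_finsetInf] at h ⊢
  intro Q hQ
  have hprim : Ideal.IsPrimary Q := hs hQ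
  rcases (Ideal.isPrimary_iff.mp hprim).2 (h Q hQ) with ha | hx
  · exact Ideal.mul_mem_right _ _ ha
  · have hx' : x ∈ Ideal.radical Q := by
      rw [← Ideal.radical_idem]
      exact ⟨n, hx⟩
    exact Ideal.mul_mem_left _ _
      (Ideal.pow_mem_of_pow_mem Q (hf Q (Ideal.pow_mem_pow hx' _)) (Finset.le_sup hQ))

open Polynomial in
theorem reesAlgebra.coeff_mem_pow_succ_of_mem_map {R : Type*} [CommRing R] {I : Ideal R}
    {p : reesAlgebra I} (hp : p ∈ I.map (algebraMap R (reesAlgebra I))) (n : ℕ) :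
    (p : R[X]).coeff n ∈ I ^ (n + 1) := by
  induction hp using Submodule.span_induction generalizing n with
  | mem p hp =>
    obtain ⟨r, hr, rfl⟩ := hp
    change (C r).coeff n ∈ _
    rw [coeff_C]
    split_ifs with h
    · simpa [h] using hr
    · exact zero_mem _
  | zero => simp
  | add p q _ _ hp hq => simpa using add_mem (hp n) (hq n)
  | smul q p _ hp =>
    change ((q : R[X]) * (p : R[X])).coeff n ∈ _
    rw [coeff_mul]
    refine Ideal.sum_mem _ fun ij hij ↦ ?_
    rw [← Finset.HasAntidiagonal.mem_antidiagonal.mp hij, add_assoc, pow_add]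
    exact Ideal.mul_mem_mul (q.2 _) (hp _)

open Polynomial in
theorem reesAlgebra.monomial_mem_map {R : Type*} [CommRing R] {I : Ideal R} {n : ℕ} {r : R}
    (hr : r ∈ I ^ (n + 1)) :
    (⟨monomial n r, monomial_mem.mpr (Ideal.pow_le_pow_right n.le_succ hr)⟩ : reesAlgebra I) ∈
      I.map (algebraMap R (reesAlgebra I)) := by
  suffices h : ∃ p ∈ I.map (algebraMap R (reesAlgebra I)), (p : R[X]) = monomial n r by
    obtain ⟨p, hp, h⟩ := h
    convert hp
    exact h.symm
  rw [pow_succ'] at hr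
  induction hr using Submodule.mul_induction_on' with
  | mem_mul_mem a ha b hb =>
    refine ⟨algebraMap R _ a * ⟨monomial n b, monomial_mem.mpr hb⟩,
      Ideal.mul_mem_right _ _ (Ideal.mem_map_of_mem _ ha), ?_⟩
    change C a * monomial n b = _
    rw [C_mul_monomial]
  | add a _ b _ ha hb =>
    obtain ⟨p, hp, hpa⟩ := ha
    obtain ⟨q, hq, hqb⟩ := hb
    exact ⟨p + q, add_mem hp hq, by simp [hpa, hqb]⟩

/-- The saturations of the powers `I ^ m` with respect to all elements stabilize at an exponent
linear in `m`. -/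
theorem Ideal.exists_forall_mul_pow_mem_pow {R : Type*} [CommRing R] [IsNoetherianRing R]
    (I : Ideal R) :
    ∃ l : ℕ, ∀ a x : R, ∀ n m : ℕ, l * m ≤ n → a * x ^ n ∈ I ^ m → a * x ^ (l * m) ∈ I ^ m := by
  obtain ⟨l, hl⟩ := Ideal.exists_forall_mul_pow_mem_of_mul_pow_mem
    (I.map (algebraMap R (reesAlgebra I)))
  have step (k n : ℕ) (a x : R) (ha : a ∈ I ^ k) (h : a * x ^ n ∈ I ^ (k + 1)) :
      a * x ^ l ∈ I ^ (k + 1) := by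
    have key (j : ℕ) : ((⟨Polynomial.monomial k a, reesAlgebra.monomial_mem.mpr ha⟩ *
        algebraMap R (reesAlgebra I) x ^ j : reesAlgebra I) : Polynomial R) =
        Polynomial.monomial k (a * x ^ j) := by
      change Polynomial.monomial k a * Polynomial.C x ^ j = _
      rw [← Polynomial.C_pow, Polynomial.monomial_mul_C]
    have := reesAlgebra.coeff_mem_pow_succ_of_mem_map
      (hl ⟨_, reesAlgebra.monomial_mem.mpr ha⟩ (algebraMap R _ x) n ?_) k
    · rwa [key, Polynomial.coeff_monomial_same] at this
    · convert reesAlgebra.monomial_mem_map h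
      exact key n
  refine ⟨l, fun a x n m hn h ↦ ?_⟩
  have hk (k : ℕ) (hkm : k ≤ m) : a * x ^ (l * k) ∈ I ^ k := by
    induction k with
    | zero => simp
    | succ k ih =>
      have hkn : l * k ≤ n := (Nat.mul_le_mul_left l (by lia)).trans hn
      have := step k (n - l * k) _ x (ih (by lia)) (by
        rw [mul_assoc, ← pow_add, Nat.add_sub_cancel' hkn]
        exact Ideal.pow_le_pow_right hkm h)
      rwa [mul_assoc, ← pow_add, ← Nat.mul_succ] at this
  exact hk m le_rfl


/-- **Proposition 1** (Rond, "Asymptotic behaviour of standard bases").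
Let `A` be a Noetherian ring and let `I` and `J` be ideals of `A`.  There exists an
integer `λ ≥ 0` such that for every `x ∈ A` and all `n, m ∈ ℕ` with `n ≥ λ * m` one has
`(xⁿ) ∩ (J + Iᵐ) = ((x^(λm)) ∩ (J + Iᵐ)) · (x^(n - λm))`. -/
theorem standard_bases_prop1 {A : Type*} [CommRing A] [IsNoetherianRing A]
    (I J : Ideal A) :
    ∃ l : ℕ, ∀ x : A, ∀ n m : ℕ, n ≥ l * m →
      Ideal.span {x ^ n} ⊓ (J + I ^ m) =
        (Ideal.span {x ^ (l * m)} ⊓ (J + I ^ m)) * Ideal.span {x ^ (n - l * m)} := by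
  obtain ⟨l, hl⟩ := Ideal.exists_forall_mul_pow_mem_pow (I.map (Ideal.Quotient.mk J))
  have hmem (a : A) (m : ℕ) :
      Ideal.Quotient.mk J a ∈ I.map (Ideal.Quotient.mk J) ^ m ↔ a ∈ J + I ^ m := by
    rw [← Ideal.map_pow, ← Ideal.mem_comap, Ideal.comap_map_quotientMk, Submodule.add_eq_sup]
  refine ⟨l, fun x n m hn ↦ ?_⟩
  have hpow : x ^ n = x ^ (l * m) * x ^ (n - l * m) := by
    rw [← pow_add, Nat.add_sub_cancel' hn]
  apply le_antisymm
  · rintro _ ⟨hy, hyJ⟩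
    obtain ⟨a, rfl⟩ := Ideal.mem_span_singleton'.mp hy
    have ha : a * x ^ (l * m) ∈ J + I ^ m := by
      rw [← hmem, map_mul, map_pow]
      refine hl _ _ n m hn ?_
      rw [← map_pow, ← map_mul, hmem]
      exact hyJ
    rw [hpow, ← mul_assoc]
    exact Ideal.mul_mem_mul ⟨Ideal.mem_span_singleton'.mpr ⟨a, rfl⟩, ha⟩
      (Ideal.mem_span_singleton_self _)
  · refine le_inf ?_ (Ideal.mul_le_left.trans inf_le_right)
    rw [hpow, ← Ideal.span_singleton_mul_span_singleton]
    exact Ideal.mul_mono_left inf_le_left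
end

section
/- Let A be a Noetherian ring, 𝔞 an ideal of A, and let B = A[𝔞t, t^{−1}] be the extended Rees algebra of 𝔞, viewed as a subring of the Laurent polynomial ring A[t, t^{−1}] generated by A, t^{−1}, and the elements at with a ∈ 𝔞. Then for every integer n ≥ 0, one has (t^{−n}B) ∩ A = 𝔞^n, i.e. an element a ∈ A lies in 𝔞^n if and only if a ∈ t^{−n}B inside A[t, t^{−1}]. -/
open LaurentPolynomial

/-- The extended Rees algebra `A[𝔞t, t⁻¹]` of an ideal `𝔞`: the `A`-subalgebra of the
Laurent polynomial ring `A[t, t⁻¹]` generated by `t⁻¹` and the elements `a * t`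
with `a ∈ 𝔞`. -/
noncomputable def extendedReesAlgebra {A : Type*} [CommRing A] (𝔞 : Ideal A) :
    Subalgebra A (LaurentPolynomial A) :=
  Algebra.adjoin A
    ({LaurentPolynomial.T (-1)} ∪
      {x | ∃ a ∈ 𝔞, x = LaurentPolynomial.C a * LaurentPolynomial.T 1})

/-- If `a ∈ 𝔞ⁿ` then `a tⁿ` lies in the extended Rees algebra of `𝔞`. -/
theorem C_mul_T_mem_extendedReesAlgebra {A : Type*} [CommRing A] {𝔞 : Ideal A} {n : ℕ} {a : A}
    (ha : a ∈ 𝔞 ^ n) :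
    (LaurentPolynomial.C a * LaurentPolynomial.T n : LaurentPolynomial A) ∈
      extendedReesAlgebra 𝔞 := by
  induction n generalizing a with
  | zero => simpa using (extendedReesAlgebra 𝔞).algebraMap_mem a
  | succ n ih =>
    rw [pow_succ] at ha
    refine Submodule.mul_induction_on ha (fun x hx y hy => ?_) (fun x y hx hy => ?_)
    · have hy' : (C y * T 1 : LaurentPolynomial A) ∈ extendedReesAlgebra 𝔞 :=
        Algebra.subset_adjoin (Or.inr ⟨y, hy, rfl⟩)
      convert mul_mem (ih hx) hy' using 1
      push_cast
      rw [map_mul, T_add]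
      ring
    · rw [map_add, add_mul]
      exact add_mem hx hy

/-- The coefficient of `tᵏ` in an element of the extended Rees algebra of `𝔞` lies in `𝔞ᵏ`,
where `𝔞ᵏ = A` for `k ≤ 0`. -/
theorem coeff_mem_pow_of_mem_extendedReesAlgebra {A : Type*} [CommRing A] {𝔞 : Ideal A}
    {x : LaurentPolynomial A} (hx : x ∈ extendedReesAlgebra 𝔞) (k : ℤ) :
    x.coeff k ∈ 𝔞 ^ k.toNat := by
  induction hx using Algebra.adjoin_induction generalizing k with
  | mem x hx =>
    rcases hx with rfl | ⟨a, ha, rfl⟩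
    · rw [T, AddMonoidAlgebra.coeff_single, Finsupp.single_apply]
      split_ifs with h
      · subst h; simp
      · exact zero_mem _
    · rw [← single_eq_C_mul_T, AddMonoidAlgebra.coeff_single, Finsupp.single_apply]
      split_ifs with h
      · subst h; simpa using ha
      · exact zero_mem _
  | algebraMap r =>
    rw [← C_eq_algebraMap, ← single_eq_C, AddMonoidAlgebra.coeff_single, Finsupp.single_apply]
    split_ifs with h
    · subst h; simp
    · exact zero_mem _
  | add x y _ _ hx hy => exact add_mem (hx k) (hy k)
  | mul x y _ _ hx hy =>
    classical
    rw [AddMonoidAlgebra.coeff_mul]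
    refine sum_mem fun i _ => sum_mem fun j _ => ?_
    dsimp only
    split_ifs with h
    · refine Ideal.pow_le_pow_right (by lia : k.toNat ≤ i.toNat + j.toNat) ?_
      rw [pow_add]
      exact Ideal.mul_mem_mul (hx i) (hy j)
    · exact zero_mem _

/-- (Rond, "Asymptotic behaviour of standard bases", proof of Corollary 2.)
For the extended Rees algebra `B = A[𝔞t, t⁻¹]` of an ideal `𝔞` of a Noetherian ring `A`
one has `t⁻ⁿ B ∩ A = 𝔞ⁿ`: an element `a ∈ A` lies in `𝔞ⁿ` if and only if, inside
`A[t, t⁻¹]`, the element `a` is of the form `t⁻ⁿ * b` with `b ∈ B`. -/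
theorem extendedReesAlgebra_inter_eq_pow
    {A : Type*} [CommRing A] [IsNoetherianRing A] (𝔞 : Ideal A) (n : ℕ) (a : A) :
    a ∈ 𝔞 ^ n ↔
      ∃ b ∈ extendedReesAlgebra 𝔞,
        (LaurentPolynomial.C a : LaurentPolynomial A) =
          LaurentPolynomial.T (-(n : ℤ)) * b := by
  constructor
  · intro ha
    refine ⟨C a * T n, C_mul_T_mem_extendedReesAlgebra ha, ?_⟩
    rw [T_mul, mul_T_assoc, add_neg_cancel, T_zero, mul_one]
  · rintro ⟨b, hb, h⟩
    have hb' : b = .single (n : ℤ) a := by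
      rw [single_eq_C_mul_T, h, T_mul, mul_T_assoc, neg_add_cancel, T_zero, mul_one]
    have hcoeff := coeff_mem_pow_of_mem_extendedReesAlgebra hb n
    rwa [hb', AddMonoidAlgebra.coeff_single, Finsupp.single_eq_same, Int.toNat_natCast] at hcoeff
end
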